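/- arXiv:2511.21056 — 8 statements merged into one kernel-verified Lean document; each statement's English description precedes it below -/
import Mathlib

section
/- Let E be a nonempty type, N ≥ 1, and L : Fin N → E → ℝ a family of losses that is nonnegative and separable: L i θ ≥ 0 for all i and θ, and there exists θ_s : E with L i θ_s = 0 for all i. Then a point θ : E is weakly Pareto optimal for L if and only if there exists an index i with L i θ = 0. -/
/-- For a nonnegative, separable family of losses, a point is weakly Pareto optimal
iff some per-sample loss vanishes at it. -/
theorem weakPareto_iff_exists_zero {E : Type*} [Nonempty E] (N : ℕ) (hN : 1 ≤ N)
    (L : Fin N → E → ℝ) (hpos : ∀ i θ, 0 ≤ L i θ)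
    (hsep : ∃ θs : E, ∀ i, L i θs = 0) (θ : E) :
    (¬ ∃ θ' : E, ∀ i, L i θ' < L i θ) ↔ ∃ i, L i θ = 0 := by
  constructor
  · intro h
    by_contra! hne
    obtain ⟨θs, hs⟩ := hsep
    exact h ⟨θs, fun i => by simpa only [hs i] using (hpos i θ).lt_of_ne' (hne i)⟩
  · rintro ⟨i, hi⟩ ⟨θ', h⟩
    exact (hpos i θ').not_gt (hi ▸ h i)
end

section
/- Let E be a nonempty type, N ≥ 1, and L : Fin N → E → ℝ nonnegative and separable (L i θ ≥ 0 for all i, θ, and there exists θ_s : E with L i θ_s = 0 for all i). Then the weakly Pareto optimal set of L equals the union, over all weight vectors λ in the probability simplex Δ^N, of the sets S(λ) of global minimizers of the weighted sum θ ↦ ∑_i λ i * L i θ; that is, WP(L) = ⋃_{λ ∈ Δ^N} S(λ). -/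
/-- For a nonnegative, separable family of losses, the weakly Pareto optimal set equals
the union over simplex weights `lam` of the sets of global minimizers of the weighted sum. -/
theorem weakPareto_eq_iUnion_weighted_argmin {E : Type*} [Nonempty E] (N : ℕ) (hN : 1 ≤ N)
    (L : Fin N → E → ℝ) (hpos : ∀ i θ, 0 ≤ L i θ)
    (hsep : ∃ θs : E, ∀ i, L i θs = 0) :
    {θ : E | ¬ ∃ θ' : E, ∀ i, L i θ' < L i θ} =
      ⋃ lam ∈ {lam : Fin N → ℝ | (∀ i, 0 ≤ lam i) ∧ ∑ i, lam i = 1},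
        {θ : E | ∀ θ' : E, ∑ i, lam i * L i θ ≤ ∑ i, lam i * L i θ'} := by
  ext θ
  simp only [Set.mem_ofPred_eq, Set.mem_iUnion, exists_prop]
  constructor
  · intro h
    obtain ⟨θs, hs⟩ := hsep
    push Not at h
    obtain ⟨i, hi⟩ := h θs
    rw [hs i] at hi
    refine ⟨Pi.single i 1, ⟨fun j => ?_, by simp⟩, fun θ' => ?_⟩
    · by_cases hj : j = i
      · subst hj; simp
      · simp [hj]
    · simpa [Pi.single_apply] using hi.trans (hpos i θ')
  · rintro ⟨lam, ⟨hnonneg, hsum⟩, hmin⟩ ⟨θ', hlt⟩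
    obtain ⟨i, -, hi⟩ : ∃ i ∈ Finset.univ, 0 < lam i :=
      Finset.exists_lt_of_sum_lt (by simp [hsum])
    refine (hmin θ').not_gt (Finset.sum_lt_sum (fun j _ => ?_) ⟨i, Finset.mem_univ i, ?_⟩)
    · exact mul_le_mul_of_nonneg_left (hlt j).le (hnonneg j)
    · exact mul_lt_mul_of_pos_left (hlt i) hi
end

section
/- (Equivalence of bilevel multi-objective optimization and bilevel data selection.) Let E be a nonempty type, N ≥ 1, L : Fin N → E → ℝ nonnegative and separable (L i θ ≥ 0 for all i, θ, and there exists θ_s : E with L i θ_s = 0 for all i), and let L₀ : E → ℝ be any upper-level validation loss. Then a point θ* : E is a global solution of the bilevel multi-objective problem (θ* ∈ WP(L) and L₀ θ* ≤ L₀ θ for every θ ∈ WP(L)) if and only if there exists λ* ∈ Δ^N such that θ* ∈ S(λ*) and L₀ θ* ≤ L₀ θ for every λ ∈ Δ^N and every θ ∈ S(λ), i.e. (λ*, θ*) is a global solution of the bilevel data-selection problem. -/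
/-- A global minimizer of a simplex-weighted sum of losses is weakly Pareto optimal. -/
theorem not_exists_forall_lt_of_weighted_sum_le {ι E : Type*} [Fintype ι] {L : ι → E → ℝ}
    {lam : ι → ℝ} (hlam : ∀ i, 0 ≤ lam i) (hsum : ∑ i, lam i = 1) {θ : E}
    (hmin : ∀ θ' : E, ∑ i, lam i * L i θ ≤ ∑ i, lam i * L i θ') :
    ¬ ∃ θ' : E, ∀ i, L i θ' < L i θ := by
  rintro ⟨θ', hlt⟩
  obtain ⟨i, -, hi⟩ : ∃ i ∈ Finset.univ, 0 < lam i :=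
    Finset.exists_lt_of_sum_lt (by simp [hsum])
  refine (hmin θ').not_gt (Finset.sum_lt_sum (fun j _ => ?_) ⟨i, Finset.mem_univ i, ?_⟩)
  · exact mul_le_mul_of_nonneg_left (hlt j).le (hlam j)
  · exact mul_lt_mul_of_pos_left (hlt i) hi

/-- For a nonnegative separable family, every weakly Pareto optimal point minimizes some
simplex-weighted sum of the losses. -/
theorem exists_weighted_sum_le_of_not_exists_forall_lt {ι E : Type*} [Fintype ι]
    {L : ι → E → ℝ} (hpos : ∀ i θ, 0 ≤ L i θ) (hsep : ∃ θs : E, ∀ i, L i θs = 0) {θ : E}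
    (hθ : ¬ ∃ θ' : E, ∀ i, L i θ' < L i θ) :
    ∃ lam : ι → ℝ, (∀ i, 0 ≤ lam i) ∧ ∑ i, lam i = 1 ∧
      ∀ θ' : E, ∑ i, lam i * L i θ ≤ ∑ i, lam i * L i θ' := by
  classical
  obtain ⟨θs, hs⟩ := hsep
  push Not at hθ
  obtain ⟨i, hi⟩ := hθ θs
  rw [hs i] at hi
  refine ⟨Pi.single i 1, fun j => ?_, by simp, fun θ' => ?_⟩
  · exact (Pi.single_nonneg.2 zero_le_one : (0 : ι → ℝ) ≤ Pi.single i 1) j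
  · simpa [Pi.single_apply] using hi.trans (hpos i θ')

/-- Equivalence of bilevel multi-objective optimization (`BMO`) and bilevel data selection
(`BDS`): `θ*` is a global solution of minimizing `L₀` over the weak Pareto set of `L`
iff there is a simplex weight `lam*` such that `(lam*, θ*)` is a global solution of
minimizing `L₀` over all pairs `(lam, θ)` with `θ` a global minimizer of the
`lam`-weighted sum of the losses. -/
theorem bmo_iff_bds {E : Type*} [Nonempty E] (N : ℕ) (hN : 1 ≤ N)
    (L : Fin N → E → ℝ) (hpos : ∀ i θ, 0 ≤ L i θ)
    (hsep : ∃ θs : E, ∀ i, L i θs = 0) (L₀ : E → ℝ) (θstar : E) :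
    ((¬ ∃ θ' : E, ∀ i, L i θ' < L i θstar) ∧
      ∀ θ : E, (¬ ∃ θ' : E, ∀ i, L i θ' < L i θ) → L₀ θstar ≤ L₀ θ) ↔
    (∃ lam : Fin N → ℝ, (∀ i, 0 ≤ lam i) ∧ (∑ i, lam i) = 1 ∧
      (∀ θ' : E, ∑ i, lam i * L i θstar ≤ ∑ i, lam i * L i θ') ∧
      ∀ lam' : Fin N → ℝ, (∀ i, 0 ≤ lam' i) → (∑ i, lam' i) = 1 →
        ∀ θ : E, (∀ θ' : E, ∑ i, lam' i * L i θ ≤ ∑ i, lam' i * L i θ') →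
          L₀ θstar ≤ L₀ θ) := by
  constructor
  · rintro ⟨hθ, hopt⟩
    obtain ⟨lam, hlam, hsum, hmin⟩ :=
      exists_weighted_sum_le_of_not_exists_forall_lt hpos hsep hθ
    exact ⟨lam, hlam, hsum, hmin, fun lam' hlam' hsum' θ hmin' =>
      hopt θ (not_exists_forall_lt_of_weighted_sum_le hlam' hsum' hmin')⟩
  · rintro ⟨lam, hlam, hsum, hmin, hopt⟩
    refine ⟨not_exists_forall_lt_of_weighted_sum_le hlam hsum hmin, fun θ hθ => ?_⟩
    obtain ⟨lam', hlam', hsum', hmin'⟩ :=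
      exists_weighted_sum_le_of_not_exists_forall_lt hpos hsep hθ
    exact hopt lam' hlam' hsum' θ hmin'
end

section
/- Let E be a nonempty type, N ≥ 2, and L : Fin N → E → ℝ nonnegative and separable (L i θ ≥ 0 for all i, θ, and there exists θ_s : E with L i θ_s = 0 for all i). Fix an index i and let L^{∖i} denote the family of losses L j for j ≠ i. Then the set difference WP(L) \ WP(L^{∖i}) equals the set of individual minimizers of L i, namely { θ : E | L i θ = 0 and L j θ ≠ 0 for every j ≠ i }. -/
/-- The difference between the weak Pareto set of the full family `L` and the weak Pareto
set of the family with the `i`-th loss removed equals the set of individual minimizers of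
`L i`: points where `L i` vanishes but no other `L j` does. -/
theorem weakPareto_diff_eq_individual_minimizers {E : Type*} [Nonempty E] (N : ℕ)
    (hN : 2 ≤ N) (L : Fin N → E → ℝ) (hpos : ∀ i θ, 0 ≤ L i θ)
    (hsep : ∃ θs : E, ∀ i, L i θs = 0) (i : Fin N) :
    {θ : E | ¬ ∃ θ' : E, ∀ j, L j θ' < L j θ} \
        {θ : E | ¬ ∃ θ' : E, ∀ j, j ≠ i → L j θ' < L j θ} =
      {θ : E | L i θ = 0 ∧ ∀ j, j ≠ i → L j θ ≠ 0} := by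
  obtain ⟨θs, hs⟩ := hsep
  ext θ
  simp only [Set.mem_sdiff, Set.mem_ofPred_eq, not_not]
  constructor
  · rintro ⟨hWP, θ', hθ'⟩
    have hpos_off : ∀ j, j ≠ i → 0 < L j θ := fun j hj => (hpos j θ').trans_lt (hθ' j hj)
    refine ⟨?_, fun j hj => (hpos_off j hj).ne'⟩
    by_contra hi
    refine hWP ⟨θs, fun j => ?_⟩
    rw [hs j]
    rcases eq_or_ne j i with rfl | hj
    · exact (hpos j θ).lt_of_ne' hi
    · exact hpos_off j hj
  · rintro ⟨hi, hne⟩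
    refine ⟨fun ⟨θ', hθ'⟩ => ?_, θs, fun j hj => ?_⟩
    · exact (hpos i θ').not_gt (hi ▸ hθ' i)
    · rw [hs j]
      exact (hpos j θ).lt_of_ne' (hne j hj)
end

section
/- (Bilevel data selection selects exactly the useful samples.) Let E be a nonempty type, N ≥ 1, L : Fin N → E → ℝ nonnegative and separable (L i θ ≥ 0 for all i, θ, and there exists θ_s : E with L i θ_s = 0 for all i), and L₀ : E → ℝ a validation loss with L₀ θ ≥ 0 for all θ and L₀ θ_v = 0 for some θ_v : E. Assume at least one sample is useful. Then for every index i: sample i is useful if and only if there exists a global solution (λ*, θ*) of the bilevel data-selection problem with λ* i > 0; equivalently, if sample i is useless then every global solution (λ*, θ*) satisfies λ* i = 0. -/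
/-- `(lam, θ)` is a global solution of the bilevel data-selection problem:
`lam` lies in the simplex, `θ` globally minimizes the `lam`-weighted sum of the losses,
and `L₀ θ` is minimal among all such pairs. -/
def IsBDSGlobalSolution {E : Type*} {N : ℕ} (L : Fin N → E → ℝ) (L₀ : E → ℝ)
    (lam : Fin N → ℝ) (θ : E) : Prop :=
  (∀ j, 0 ≤ lam j) ∧ (∑ j, lam j) = 1 ∧
    (∀ θ' : E, ∑ j, lam j * L j θ ≤ ∑ j, lam j * L j θ') ∧
    ∀ lam' : Fin N → ℝ, (∀ j, 0 ≤ lam' j) → (∑ j, lam' j) = 1 →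
      ∀ θ'' : E, (∀ θ' : E, ∑ j, lam' j * L j θ'' ≤ ∑ j, lam' j * L j θ') →
        L₀ θ ≤ L₀ θ''

/-- A point where sample `i` and the validation loss both vanish gives a global solution
concentrated on `i`. -/
theorem isBDSGlobalSolution_single {E : Type*} {N : ℕ} {L : Fin N → E → ℝ} {L₀ : E → ℝ}
    (hpos : ∀ i θ, 0 ≤ L i θ) (hL0 : ∀ θ, 0 ≤ L₀ θ) {i : Fin N} {θ : E}
    (hi : L i θ = 0) (hθ : L₀ θ = 0) :
    IsBDSGlobalSolution L L₀ (Pi.single i 1) θ := by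
  refine ⟨fun j => ?_, by simp, fun θ' => ?_, fun _ _ _ θ'' _ => hθ ▸ hL0 θ''⟩
  · by_cases h : j = i
    · subst h; simp
    · simp [h]
  · simpa [Pi.single_apply, hi] using hpos i θ'

/-- At a global solution of a separable problem, every sample of positive weight is
fitted exactly. -/
theorem IsBDSGlobalSolution.loss_eq_zero {E : Type*} {N : ℕ} {L : Fin N → E → ℝ}
    {L₀ : E → ℝ} {lam : Fin N → ℝ} {θ : E} (h : IsBDSGlobalSolution L L₀ lam θ)
    (hpos : ∀ i θ, 0 ≤ L i θ) (hsep : ∃ θs : E, ∀ i, L i θs = 0) {i : Fin N}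
    (hi : 0 < lam i) : L i θ = 0 := by
  obtain ⟨θs, hs⟩ := hsep
  have hnonneg : ∀ j ∈ Finset.univ, 0 ≤ lam j * L j θ :=
    fun j _ => mul_nonneg (h.1 j) (hpos j θ)
  have hsum : ∑ j, lam j * L j θ = 0 :=
    le_antisymm (by simpa [hs] using h.2.2.1 θs) (Finset.sum_nonneg hnonneg)
  have hmul := (Finset.sum_eq_zero_iff_of_nonneg hnonneg).1 hsum i (Finset.mem_univ i)
  exact (mul_eq_zero.1 hmul).resolve_left hi.ne'

/-- If some sample is useful, the validation loss vanishes at every global solution. -/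
theorem IsBDSGlobalSolution.validation_eq_zero {E : Type*} {N : ℕ} {L : Fin N → E → ℝ}
    {L₀ : E → ℝ} {lam : Fin N → ℝ} {θ : E} (h : IsBDSGlobalSolution L L₀ lam θ)
    (hpos : ∀ i θ, 0 ≤ L i θ) (hL0 : ∀ θ, 0 ≤ L₀ θ)
    (huseful : ∃ i : Fin N, ∃ θ : E, L i θ = 0 ∧ L₀ θ = 0) : L₀ θ = 0 := by
  obtain ⟨k, θk, hk, hk0⟩ := huseful
  obtain ⟨h1, h2, h3, -⟩ := isBDSGlobalSolution_single hpos hL0 hk hk0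
  exact le_antisymm (hk0 ▸ h.2.2.2 _ h1 h2 θk h3) (hL0 θ)

/-- Bilevel data selection selects exactly the useful samples: sample `i` is useful
(i.e. some model fits it perfectly and is optimal on validation) iff some global solution
of the bilevel data-selection problem puts positive weight on it; equivalently, if sample
`i` is useless then every global solution puts zero weight on it. -/
theorem bds_selects_useful {E : Type*} [Nonempty E] (N : ℕ) (hN : 1 ≤ N)
    (L : Fin N → E → ℝ) (hpos : ∀ i θ, 0 ≤ L i θ)
    (hsep : ∃ θs : E, ∀ i, L i θs = 0)
    (L₀ : E → ℝ) (hL0 : ∀ θ, 0 ≤ L₀ θ) (hval : ∃ θv : E, L₀ θv = 0)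
    (huseful : ∃ i : Fin N, ∃ θ : E, L i θ = 0 ∧ L₀ θ = 0) (i : Fin N) :
    ((∃ θ : E, L i θ = 0 ∧ L₀ θ = 0) ↔
      ∃ lam : Fin N → ℝ, ∃ θstar : E,
        IsBDSGlobalSolution L L₀ lam θstar ∧ 0 < lam i) ∧
    (¬ (∃ θ : E, L i θ = 0 ∧ L₀ θ = 0) →
      ∀ lam : Fin N → ℝ, ∀ θstar : E,
        IsBDSGlobalSolution L L₀ lam θstar → lam i = 0) := by
  have key : ∀ lam θ, IsBDSGlobalSolution L L₀ lam θ → 0 < lam i → L i θ = 0 ∧ L₀ θ = 0 :=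
    fun _ _ h hi => ⟨h.loss_eq_zero hpos hsep hi, h.validation_eq_zero hpos hL0 huseful⟩
  refine ⟨⟨?_, ?_⟩, ?_⟩
  · rintro ⟨θ, hi, hθ⟩
    exact ⟨Pi.single i 1, θ, isBDSGlobalSolution_single hpos hL0 hi hθ, by simp⟩
  · rintro ⟨lam, θ, h, hi⟩
    exact ⟨θ, key lam θ h hi⟩
  · intro hn lam θ h
    by_contra hne
    exact hn ⟨θ, key lam θ h ((h.1 i).lt_of_ne' hne)⟩
end

section
/- (Strict improvement of bilevel data selection over unfiltered training, the ρ = 1 case.) Let E be a nonempty type, N ≥ 1, L : Fin N → E → ℝ nonnegative and separable (L i θ ≥ 0 for all i, θ, and there exists θ_s : E with L i θ_s = 0 for all i), and L₀ : E → ℝ a validation loss with L₀ θ ≥ 0 for all θ and L₀ θ_v = 0 for some θ_v : E. Assume at least one sample is useful, and assume there is no joint zero: there is no θ : E with L₀ θ = 0 and L i θ = 0 for all i. Then there exists θ* ∈ WP(L) with L₀ θ* = 0, and for every θ̃ that globally minimizes the unfiltered average loss θ ↦ (1/N) ∑_i L i θ over E, one has L₀ θ* < L₀ θ̃. -/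
/-- Strict improvement of bilevel data selection over unfiltered training (`ρ = 1` case):
if some sample is useful but no model simultaneously achieves zero validation loss and
zero loss on every sample, then the bilevel solution `θ*` (weakly Pareto optimal with
`L₀ θ* = 0`) has strictly smaller validation loss than every global minimizer of the
unfiltered average loss. -/
theorem bds_strictly_improves_over_mixing {E : Type*} [Nonempty E] (N : ℕ) (hN : 1 ≤ N)
    (L : Fin N → E → ℝ) (hpos : ∀ i θ, 0 ≤ L i θ)
    (hsep : ∃ θs : E, ∀ i, L i θs = 0)
    (L₀ : E → ℝ) (hL0 : ∀ θ, 0 ≤ L₀ θ) (hval : ∃ θv : E, L₀ θv = 0)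
    (huseful : ∃ i : Fin N, ∃ θ : E, L i θ = 0 ∧ L₀ θ = 0)
    (hnojoint : ¬ ∃ θ : E, L₀ θ = 0 ∧ ∀ i, L i θ = 0) :
    ∃ θstar : E, (¬ ∃ θ' : E, ∀ i, L i θ' < L i θstar) ∧ L₀ θstar = 0 ∧
      ∀ θtilde : E,
        (∀ θ : E, (1 / (N : ℝ)) * ∑ i, L i θtilde ≤ (1 / (N : ℝ)) * ∑ i, L i θ) →
        L₀ θstar < L₀ θtilde := by
  obtain ⟨i, θ, hLi, hθ⟩ := huseful
  obtain ⟨θs, hs⟩ := hsep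
  refine ⟨θ, fun ⟨θ', h⟩ => ?_, hθ, fun θt hmin => ?_⟩
  · exact absurd (h i) (by rw [hLi]; exact not_lt.mpr (hpos i θ'))
  · rw [hθ]
    refine (hL0 θt).lt_of_ne fun h0 => hnojoint ⟨θt, h0.symm, fun j => ?_⟩
    have hN' : (0 : ℝ) < 1 / N := one_div_pos.mpr (Nat.cast_pos.mpr hN)
    have hle : ∑ i, L i θt ≤ 0 := by
      simpa [hs] using le_of_mul_le_mul_left (hmin θs) hN'
    have hsum : ∑ i, L i θt = 0 :=
      le_antisymm hle (Finset.sum_nonneg fun i _ => hpos i θt)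
    exact (Finset.sum_eq_zero_iff_of_nonneg fun i _ => hpos i θt).mp hsum j (Finset.mem_univ j)
end

section
/- Let E be a nonempty type, M ≥ 1, and L : Fin M → E → ℝ a family of losses that is nonnegative and separable (L m θ ≥ 0 for all m, θ, and there exists θ_s : E with L m θ_s = 0 for all m). Then for every θ : E, the supremum over θ' : E of the finite minimum min_{m} ( L m θ − L m θ' ) equals min_{m} L m θ; that is, ⨆_{θ' : E} (⨅_{m}, (L m θ − L m θ')) = ⨅_{m}, L m θ (a supremum in ℝ over the nonempty, bounded-above family). -/
/-- For a nonnegative, separable family of losses, the merit function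
`u(θ) = sup_{θ'} min_m (L m θ − L m θ')` reduces to the minimum per-sample loss:
`⨆ θ', ⨅ m, (L m θ − L m θ') = ⨅ m, L m θ`. -/
theorem merit_function_eq_min_loss {E : Type*} [Nonempty E] (M : ℕ) (hM : 1 ≤ M)
    (L : Fin M → E → ℝ) (hpos : ∀ m θ, 0 ≤ L m θ)
    (hsep : ∃ θs : E, ∀ m, L m θs = 0) (θ : E) :
    ⨆ θ' : E, ⨅ m : Fin M, (L m θ - L m θ') = ⨅ m : Fin M, L m θ := by
  have : Nonempty (Fin M) := ⟨⟨0, hM⟩⟩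
  obtain ⟨θs, hs⟩ := hsep
  have hle : ∀ θ', ⨅ m : Fin M, (L m θ - L m θ') ≤ ⨅ m : Fin M, L m θ := fun θ' =>
    ciInf_mono (Set.finite_range _).bddBelow fun m => sub_le_self _ (hpos m θ')
  refine le_antisymm (ciSup_le hle) ?_
  refine le_ciSup_of_le ⟨_, Set.forall_mem_range.2 hle⟩ θs ?_
  simp [hs]
end

section
/- Let E be a nonempty type, M ≥ 1, τ > 0, and L : Fin M → E → ℝ a family of losses that is nonnegative and separable (L m θ ≥ 0 for all m, θ, and there exists θ_s : E with L m θ_s = 0 for all m). Define LSE(q; τ) = (1/τ) * Real.log (∑_m Real.exp (τ * q m)) for q : Fin M → ℝ. Then for every θ : E, LSE((fun m => − L m θ); τ) − (Real.log M)/τ ≤ ⨅_{θ' : E} LSE((fun m => L m θ' − L m θ); τ) ≤ LSE((fun m => − L m θ); τ), where the infimum is the real infimum over the nonempty, bounded-below family. -/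
/-- The log-sum-exponential function with temperature `τ > 0`:
`LSE(q; τ) = (1/τ)·log(∑_m exp(τ q_m))`. -/
noncomputable def lse {M : ℕ} (τ : ℝ) (q : Fin M → ℝ) : ℝ :=
  (1 / τ) * Real.log (∑ m : Fin M, Real.exp (τ * q m))

theorem lse_mono {M : ℕ} (hM : 1 ≤ M) {τ : ℝ} (hτ : 0 < τ) {p q : Fin M → ℝ} (h : p ≤ q) :
    lse τ p ≤ lse τ q := by
  have : Nonempty (Fin M) := ⟨⟨0, hM⟩⟩
  have hsum : 0 < ∑ m : Fin M, Real.exp (τ * p m) :=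
    Finset.sum_pos (fun _ _ => Real.exp_pos _) Finset.univ_nonempty
  refine mul_le_mul_of_nonneg_left (Real.log_le_log hsum ?_) (by positivity)
  exact Finset.sum_le_sum fun m _ =>
    Real.exp_le_exp.mpr (mul_le_mul_of_nonneg_left (h m) hτ.le)

/-- Under separability, the LSE-smoothed merit function `inf_{θ'} LSE(L(θ') − L(θ); τ)`
coincides with `LSE(−L(θ); τ)` up to the additive constant `(log M)/τ`. -/
theorem lse_merit_bounds {E : Type*} [Nonempty E] (M : ℕ) (hM : 1 ≤ M)
    (τ : ℝ) (hτ : 0 < τ) (L : Fin M → E → ℝ) (hpos : ∀ m θ, 0 ≤ L m θ)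
    (hsep : ∃ θs : E, ∀ m, L m θs = 0) (θ : E) :
    lse τ (fun m => - L m θ) - Real.log M / τ ≤
        ⨅ θ' : E, lse τ (fun m => L m θ' - L m θ) ∧
      ⨅ θ' : E, lse τ (fun m => L m θ' - L m θ) ≤ lse τ (fun m => - L m θ) := by
  obtain ⟨θs, hs⟩ := hsep
  have hle : ∀ θ' : E, lse τ (fun m => - L m θ) ≤ lse τ (fun m => L m θ' - L m θ) :=
    fun θ' => lse_mono hM hτ fun m => by linarith [hpos m θ']
  constructor
  · have hlog : 0 ≤ Real.log M / τ :=
      div_nonneg (Real.log_natCast_nonneg M) hτ.le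
    exact (sub_le_self _ hlog).trans (le_ciInf hle)
  · refine (ciInf_le ⟨_, Set.forall_mem_range.mpr hle⟩ θs).trans_eq ?_
    simp only [hs, zero_sub]
end
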